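/- arXiv:0809.4205 — 4 statements merged into one kernel-verified Lean document; each statement's English description precedes it below -/
import Mathlib

section
/- Let X and Y be integrable real-valued random variables with X ≤cx Y. Then for every integer k ≥ 1, E Y_{1:k} ≤ E X_{1:k} and E X_{k:k} ≤ E Y_{k:k}. -/
open MeasureTheory Filter Topology ProbabilityTheory

noncomputable section

/-- `ConvexOrder μ ν` means the distribution `μ` is dominated by `ν` in the convex order:
`∫ φ dμ ≤ ∫ φ dν` for every convex function `φ : ℝ → ℝ` for which both integrals are
well defined. -/
def ConvexOrder (μ ν : Measure ℝ) : Prop :=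
  ∀ φ : ℝ → ℝ, ConvexOn ℝ Set.univ φ → Integrable φ μ → Integrable φ ν →
    ∫ x, φ x ∂μ ≤ ∫ x, φ x ∂ν

/-- The discrete measure on `ℝ` supported on the nonnegative integers with weights `w k`. -/
def discreteMeasure (w : ℕ → ℝ) : Measure ℝ :=
  Measure.sum fun k => ENNReal.ofReal (w k) • Measure.dirac (k : ℝ)

/-- The Poisson probabilities with mean `θ`. -/
def poissonPMFReal (θ : ℝ) (k : ℕ) : ℝ := Real.exp (-θ) * θ ^ k / k.factorial

/-- The Poisson distribution with mean `θ`, as a measure on `ℝ`. -/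
def poissonMeasure (θ : ℝ) : Measure ℝ := discreteMeasure (poissonPMFReal θ)

/-- The binomial probabilities with parameters `m` and `q`. -/
def binomialPMFReal (m : ℕ) (q : ℝ) (k : ℕ) : ℝ :=
  (m.choose k) * q ^ k * (1 - q) ^ (m - k)

/-- The binomial distribution with parameters `m` and `q`, as a measure on `ℝ`. -/
def binomialMeasure (m : ℕ) (q : ℝ) : Measure ℝ := discreteMeasure (binomialPMFReal m q)

/-- The negative binomial probabilities: `P(Z(t,θ) = k) =
(Γ(k + 1/t)/(k! Γ(1/t))) (θt)^k / (1 + θt)^(k + 1/t)`; this distribution has mean `θ`. -/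
def negBinomialPMFReal (t θ : ℝ) (k : ℕ) : ℝ :=
  Real.Gamma (k + 1 / t) / (k.factorial * Real.Gamma (1 / t)) * (θ * t) ^ k /
    (1 + θ * t) ^ ((k : ℝ) + 1 / t)

/-- The negative binomial distribution `Z(t,θ)`, as a measure on `ℝ`. -/
def negBinomialMeasure (t θ : ℝ) : Measure ℝ := discreteMeasure (negBinomialPMFReal t θ)

/-- Zero inflation: the mixture of the point mass at `0` with weight `p` and `μ` with
weight `1 - p`. -/
def ziMeasure (p : ℝ) (μ : Measure ℝ) : Measure ℝ :=
  ENNReal.ofReal p • Measure.dirac (0 : ℝ) + ENNReal.ofReal (1 - p) • μ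

/-- The zero-inflated Poisson distribution `Y(θ,p)`: mixture of the point mass at `0` with
weight `p` and the Poisson distribution with mean `θ/(1-p)` with weight `1-p`. -/
def ZIP (θ p : ℝ) : Measure ℝ := ziMeasure p (poissonMeasure (θ / (1 - p)))

/-- The zero-inflated binomial distribution `X(m,θ,p)`: mixture of the point mass at `0` with
weight `p` and the binomial distribution with parameters `m` and `θ/(m(1-p))` with
weight `1-p`. -/
def ZIB (m : ℕ) (θ p : ℝ) : Measure ℝ :=
  ziMeasure p (binomialMeasure m (θ / (m * (1 - p))))

/-- The zero-inflated negative binomial distribution of the first kind `Z₁(t,θ,p)`: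
mixture of the point mass at `0` with weight `p` and `Z(t(1-p), θ/(1-p))` with weight `1-p`. -/
def ZINB₁ (t θ p : ℝ) : Measure ℝ :=
  ziMeasure p (negBinomialMeasure (t * (1 - p)) (θ / (1 - p)))

/-- The zero-inflated negative binomial distribution of the second kind `Z₂(t,θ,p)`:
mixture of the point mass at `0` with weight `p` and `Z(t, θ/(1-p))` with weight `1-p`. -/
def ZINB₂ (t θ p : ℝ) : Measure ℝ :=
  ziMeasure p (negBinomialMeasure t (θ / (1 - p)))

/-- The probability mass function of the zero-inflated negative binomial
distribution `Z₂(t,θ,p)`. -/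
def zinb2PMFReal (t θ p : ℝ) (k : ℕ) : ℝ :=
  (if k = 0 then p else 0) + (1 - p) * negBinomialPMFReal t (θ / (1 - p)) k

/-- The expected value of the maximum of `k` independent copies of a random variable with
distribution `μ`. -/
def expMax (μ : Measure ℝ) (k : ℕ) : ℝ :=
  ∫ x : Fin k → ℝ, (⨆ i, x i) ∂(Measure.pi fun _ => μ)

/-- The expected value of the minimum of `k` independent copies of a random variable with
distribution `μ`. -/
def expMin (μ : Measure ℝ) (k : ℕ) : ℝ :=
  ∫ x : Fin k → ℝ, (⨅ i, x i) ∂(Measure.pi fun _ => μ)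

/-- The modified Bessel function of the first kind of integer order `n`. -/
def besselI (n : ℕ) (x : ℝ) : ℝ :=
  ∑' j : ℕ, (x / 2) ^ (2 * j + n) / (j.factorial * (j + n).factorial)

/-- `M₂ θ`: the expected value of the maximum of two independent Poisson random variables
with mean `θ`. -/
def M₂ (x : ℝ) : ℝ := x + x * Real.exp (-2 * x) * (besselI 0 (2 * x) + besselI 1 (2 * x))

/-- The discrepancy `Δ₂:₂(θ,p) = 2pθ + (1-p)² M₂(θ/(1-p)) − M₂(θ)`. -/
def Δdisc (θ p : ℝ) : ℝ := 2 * p * θ + (1 - p) ^ 2 * M₂ (θ / (1 - p)) - M₂ θ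

/-- The asymptotic variance `σ²(θ)` of `√n Δ₂:₂` under the Poisson null hypothesis. -/
def σsq (θ : ℝ) : ℝ :=
  θ ^ 2 * (1 - Real.exp (-2 * θ) *
      ((1 + θ) * besselI 0 (2 * θ) - besselI 1 (2 * θ) + θ * besselI 2 (2 * θ))) ^ 2 /
    (Real.exp θ - 1 - θ)

/-- A Lipschitz function of finitely many independent integrable real variables is integrable. -/
lemma LipschitzWith.integrable_pi {μ : Measure ℝ} [IsProbabilityMeasure μ] (hμ : Integrable id μ)
    {k : ℕ} {K : NNReal} {f : (Fin k → ℝ) → ℝ} (hf : LipschitzWith K f) :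
    Integrable f (Measure.pi fun _ => μ) := by
  have hsum : Integrable (fun x : Fin k → ℝ => |f 0| + K * ∑ i, |x i|)
      (Measure.pi fun _ => μ) := by
    refine (integrable_const _).add (Integrable.const_mul ?_ _)
    refine integrable_finsetSum _ fun i _ => ?_
    exact (integrable_comp_eval (μ := fun _ : Fin k => μ) (i := i) hμ).abs
  refine hsum.mono' hf.continuous.aestronglyMeasurable (ae_of_all _ fun x => ?_)
  have h := hf.dist_le_mul x 0
  rw [Real.dist_eq, dist_zero_right] at h
  have hx : ‖x‖ ≤ ∑ i, |x i| :=
    (pi_norm_le_iff_of_nonneg (Finset.sum_nonneg fun i _ => abs_nonneg _)).2 fun i =>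
      Finset.single_le_sum (f := fun i => |x i|) (fun i _ => abs_nonneg _) (Finset.mem_univ i)
  have h₁ : K * ‖x‖ ≤ K * ∑ i, |x i| := mul_le_mul_of_nonneg_left hx K.2
  have h₂ := abs_sub_abs_le_abs_sub (f x) (f 0)
  rw [Real.norm_eq_abs]
  linarith

/-- The integral against a product measure, with the first coordinate integrated separately. -/
lemma integral_pi_succ {μ : Measure ℝ} [IsProbabilityMeasure μ] {k : ℕ}
    (f : (Fin (k + 1) → ℝ) → ℝ) :
    ∫ x, f x ∂(Measure.pi fun _ => μ) =
      ∫ p : ℝ × (Fin k → ℝ), f (Fin.cons p.1 p.2) ∂(μ.prod (Measure.pi fun _ => μ)) := by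
  have h := (measurePreserving_piFinSuccAbove (fun _ : Fin (k + 1) => μ) 0).symm
  rw [← h.integral_comp (MeasurableEquiv.measurableEmbedding _)]
  refine integral_congr_ae (ae_of_all _ fun p => ?_)
  simp [MeasurableEquiv.piFinSuccAbove, Fin.insertNthEquiv]

/-- Products of measures increasing in the convex order have increasing integrals of
Lipschitz convex functions. -/
lemma ConvexOrder.integral_pi_le {μ ν : Measure ℝ} [IsProbabilityMeasure μ]
    [IsProbabilityMeasure ν] (hμ : Integrable id μ) (hν : Integrable id ν)
    (hcx : ConvexOrder μ ν) {k : ℕ} {K : NNReal} {f : (Fin k → ℝ) → ℝ}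
    (hf : LipschitzWith K f) (hconv : ConvexOn ℝ Set.univ f) :
    ∫ x, f x ∂(Measure.pi fun _ => μ) ≤ ∫ x, f x ∂(Measure.pi fun _ => ν) := by
  induction k with
  | zero => rw [Measure.pi_of_empty, Measure.pi_of_empty]
  | succ k ih =>
    have hcons : LipschitzWith 1 fun p : ℝ × (Fin k → ℝ) =>
        (Fin.cons p.1 p.2 : Fin (k + 1) → ℝ) := by
      refine LipschitzWith.of_dist_le_mul fun p q => ?_
      rw [NNReal.coe_one, one_mul, dist_pi_le_iff dist_nonneg]
      refine Fin.cases ?_ fun i => ?_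
      · exact le_max_left _ _
      · exact (dist_le_pi_dist p.2 q.2 i).trans (le_max_right _ _)
    have hslice (a : ℝ) : LipschitzWith K fun y : Fin k → ℝ => f (Fin.cons a y) := by
      have h := hf.comp (hcons.comp (LipschitzWith.prodMk_left a))
      simpa [Function.comp_def] using h
    have hcomb (s t a b : ℝ) (y z : Fin k → ℝ) :
        (Fin.cons (s • a + t • b) (s • y + t • z) : Fin (k + 1) → ℝ) =
          s • (Fin.cons a y : Fin (k + 1) → ℝ) + t • (Fin.cons b z : Fin (k + 1) → ℝ) := by
      ext i
      refine Fin.cases ?_ (fun i => ?_) i <;> simp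
    have hsliceconv (a : ℝ) :
        ConvexOn ℝ Set.univ fun y : Fin k → ℝ => f (Fin.cons a y) := by
      refine ⟨convex_univ, fun y _ z _ s t hs ht hst => ?_⟩
      have h := hconv.2 (Set.mem_univ (Fin.cons a y)) (Set.mem_univ (Fin.cons a z)) hs ht hst
      rwa [← hcomb, ← add_smul, hst, one_smul] at h
    have hint (ρ σ : Measure ℝ) [IsProbabilityMeasure ρ] [IsProbabilityMeasure σ]
        (hρ : Integrable id ρ) (hσ : Integrable id σ) :
        Integrable (fun p : ℝ × (Fin k → ℝ) => f (Fin.cons p.1 p.2))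
          (ρ.prod (Measure.pi fun _ => σ)) := by
      have hg : Integrable (fun p : ℝ × (Fin k → ℝ) => |f (Fin.cons 0 p.2)| + K * |p.1|)
          (ρ.prod (Measure.pi fun _ => σ)) := by
        refine Integrable.add ?_ (Integrable.const_mul ?_ _)
        · exact (((hslice 0).integrable_pi hσ).comp_snd ρ).abs
        · exact (hρ.comp_fst _).abs
      refine hg.mono' (hf.continuous.comp hcons.continuous).aestronglyMeasurable
        (ae_of_all _ fun p => ?_)
      have h := (hf.comp (hcons.comp (LipschitzWith.prodMk_right p.2))).dist_le_mul p.1 0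
      simp only [Function.comp, Real.dist_eq, mul_one, sub_zero] at h
      have h₂ := abs_sub_abs_le_abs_sub (f (Fin.cons p.1 p.2)) (f (Fin.cons 0 p.2))
      rw [Real.norm_eq_abs]
      linarith
    have hgconv : ConvexOn ℝ Set.univ fun a : ℝ =>
        ∫ y : Fin k → ℝ, f (Fin.cons a y) ∂(Measure.pi fun _ => ν) := by
      refine ⟨convex_univ, fun a _ b _ s t hs ht hst => ?_⟩
      have ha := (hslice a).integrable_pi hν
      have hb := (hslice b).integrable_pi hν
      simp only [smul_eq_mul]
      rw [← integral_const_mul, ← integral_const_mul,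
        ← integral_add (ha.const_mul s) (hb.const_mul t)]
      refine integral_mono ((hslice _).integrable_pi hν)
        ((ha.const_mul s).add (hb.const_mul t)) fun y => ?_
      have h := hconv.2 (Set.mem_univ (Fin.cons a y)) (Set.mem_univ (Fin.cons b y)) hs ht hst
      rwa [← hcomb, ← add_smul, hst, one_smul] at h
    rw [integral_pi_succ, integral_pi_succ, integral_prod _ (hint μ μ hμ hμ),
      integral_prod _ (hint ν ν hν hν)]
    refine (integral_mono (hint μ μ hμ hμ).integral_prod_left
      (hint μ ν hμ hν).integral_prod_left fun a => ih (hslice a) (hsliceconv a)).trans ?_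
    exact hcx _ hgconv (hint μ ν hμ hν).integral_prod_left (hint ν ν hν hν).integral_prod_left

lemma lipschitzWith_iSup_pi {k : ℕ} [Nonempty (Fin k)] :
    LipschitzWith 1 fun x : Fin k → ℝ => ⨆ i, x i := by
  refine LipschitzWith.of_le_add fun x y => ciSup_le fun i => ?_
  have h₁ := le_ciSup (Set.finite_range y).bddAbove i
  have h₂ := dist_le_pi_dist x y i
  rw [Real.dist_eq] at h₂
  linarith [le_abs_self (x i - y i)]

lemma convexOn_iSup_pi {k : ℕ} [Nonempty (Fin k)] :
    ConvexOn ℝ Set.univ fun x : Fin k → ℝ => ⨆ i, x i := by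
  refine ⟨convex_univ, fun x _ y _ s t hs ht _ => ciSup_le fun i => ?_⟩
  exact add_le_add
    (mul_le_mul_of_nonneg_left (le_ciSup (Set.finite_range x).bddAbove i) hs)
    (mul_le_mul_of_nonneg_left (le_ciSup (Set.finite_range y).bddAbove i) ht)

lemma iSup_neg_pi {k : ℕ} [Nonempty (Fin k)] (x : Fin k → ℝ) :
    ⨆ i, (-x) i = -⨅ i, x i := by
  refine le_antisymm (ciSup_le fun i => ?_) ?_
  · exact neg_le_neg (ciInf_le (Set.finite_range x).bddBelow i)
  · rw [neg_le]
    exact le_ciInf fun i => neg_le.1 (le_ciSup (Set.finite_range (-x)).bddAbove i)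

/-- If `X ≤cx Y` for integrable real random variables (identified with their
distributions `μ`, `ν`), then for every `k ≥ 1` we have `E Y_{1:k} ≤ E X_{1:k}` and
`E X_{k:k} ≤ E Y_{k:k}`. -/
theorem expected_extremes_of_convexOrder
    (μ ν : Measure ℝ) [IsProbabilityMeasure μ] [IsProbabilityMeasure ν]
    (hμ : Integrable id μ) (hν : Integrable id ν)
    (hcx : ConvexOrder μ ν) :
    ∀ k : ℕ, 1 ≤ k → expMin ν k ≤ expMin μ k ∧ expMax μ k ≤ expMax ν k := by
  intro k hk
  have : Nonempty (Fin k) := ⟨⟨0, hk⟩⟩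
  refine ⟨?_, hcx.integral_pi_le hμ hν lipschitzWith_iSup_pi convexOn_iSup_pi⟩
  have hneg := hcx.integral_pi_le hμ hν (f := fun x : Fin k → ℝ => ⨆ i, (-x) i)
    (lipschitzWith_iSup_pi.comp LipschitzWith.id.neg)
    (convexOn_iSup_pi.comp_linearMap (-LinearMap.id))
  simp only [iSup_neg_pi, integral_neg] at hneg
  exact neg_le_neg_iff.1 hneg

end
end

section
/- Let X and Y be integrable real-valued random variables with X ≤cx Y. If for some integer k ≥ 2 either E X_{1:k} = E Y_{1:k} or E X_{k:k} = E Y_{k:k}, then X and Y have the same distribution. -/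
open MeasureTheory Filter Topology ProbabilityTheory

noncomputable section

/-! ### The law of the maximum of two independent variables -/

/-- The function `c ↦ E max(X, c)` for `X` distributed according to `ρ`. -/
def maxFun (ρ : Measure ℝ) (c : ℝ) : ℝ := ∫ x, max x c ∂ρ

/-- The distribution of `max X Y` for independent `X ∼ ρ` and `Y ∼ σ`. -/
def maxLaw (ρ σ : Measure ℝ) : Measure ℝ := (ρ.prod σ).map fun z => max z.1 z.2

lemma integrable_max_prod {ρ σ : Measure ℝ} [IsProbabilityMeasure ρ] [IsProbabilityMeasure σ]
    (hρ : Integrable id ρ) (hσ : Integrable id σ) :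
    Integrable (fun z : ℝ × ℝ => max z.1 z.2) (ρ.prod σ) :=
  (hρ.comp_fst σ).sup (hσ.comp_snd ρ)

lemma integrable_max_const {ρ : Measure ℝ} [IsProbabilityMeasure ρ]
    (hρ : Integrable id ρ) (c : ℝ) : Integrable (fun x => max x c) ρ :=
  hρ.sup (integrable_const c)

lemma integrable_maxFun {ρ σ : Measure ℝ} [IsProbabilityMeasure ρ] [IsProbabilityMeasure σ]
    (hρ : Integrable id ρ) (hσ : Integrable id σ) : Integrable (maxFun ρ) σ :=
  (integrable_max_prod hρ hσ).integral_prod_right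

lemma integral_maxFun_comm {ρ σ : Measure ℝ} [IsProbabilityMeasure ρ] [IsProbabilityMeasure σ]
    (hρ : Integrable id ρ) (hσ : Integrable id σ) :
    ∫ c, maxFun ρ c ∂σ = ∫ c, maxFun σ c ∂ρ := by
  have h := integral_integral_swap (f := fun x y : ℝ => max x y) (integrable_max_prod hρ hσ)
  simp only [maxFun, ← h]
  simp only [max_comm]

instance (ρ σ : Measure ℝ) [IsProbabilityMeasure ρ] [IsProbabilityMeasure σ] :
    IsProbabilityMeasure (maxLaw ρ σ) :=
  Measure.isProbabilityMeasure_map (by fun_prop)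

lemma integrable_id_maxLaw {ρ σ : Measure ℝ} [IsProbabilityMeasure ρ] [IsProbabilityMeasure σ]
    (hρ : Integrable id ρ) (hσ : Integrable id σ) : Integrable id (maxLaw ρ σ) := by
  rw [maxLaw, integrable_map_measure (by fun_prop) (by fun_prop)]
  exact integrable_max_prod hρ hσ

lemma integral_id_maxLaw {ρ σ : Measure ℝ} [IsProbabilityMeasure ρ] [IsProbabilityMeasure σ]
    (hρ : Integrable id ρ) (hσ : Integrable id σ) :
    ∫ x, x ∂(maxLaw ρ σ) = ∫ c, maxFun ρ c ∂σ := by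
  rw [maxLaw, integral_map (by fun_prop) (by fun_prop),
    integral_prod_symm _ (integrable_max_prod hρ hσ)]
  rfl

lemma maxFun_maxLaw {ρ σ : Measure ℝ} [IsProbabilityMeasure ρ] [IsProbabilityMeasure σ]
    (hρ : Integrable id ρ) (hσ : Integrable id σ) (c : ℝ) :
    maxFun (maxLaw ρ σ) c = ∫ y, maxFun ρ (max y c) ∂σ := by
  rw [maxFun, maxLaw, integral_map (by fun_prop) (by fun_prop), integral_prod_symm]
  · simp only [maxFun, max_assoc]
  · exact (integrable_max_prod hρ hσ).sup (integrable_const c)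

lemma maxFun_maxLaw' {ρ σ : Measure ℝ} [IsProbabilityMeasure ρ] [IsProbabilityMeasure σ]
    (hρ : Integrable id ρ) (hσ : Integrable id σ) (c : ℝ) :
    maxFun (maxLaw ρ σ) c = ∫ x, maxFun σ (max x c) ∂ρ := by
  rw [maxFun, maxLaw, integral_map (by fun_prop) (by fun_prop), integral_prod]
  · simp only [maxFun, max_left_comm, max_assoc]
  · exact (integrable_max_prod hρ hσ).sup (integrable_const c)

lemma integrable_maxFun_max {ρ σ : Measure ℝ} [IsProbabilityMeasure ρ] [IsProbabilityMeasure σ]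
    (hρ : Integrable id ρ) (hσ : Integrable id σ) (c : ℝ) :
    Integrable (fun y => maxFun ρ (max y c)) σ := by
  have h : Integrable (fun z : ℝ × ℝ => max z.1 (max z.2 c)) (ρ.prod σ) := by
    simp only [← max_assoc]
    exact (integrable_max_prod hρ hσ).sup (integrable_const c)
  exact h.integral_prod_right

lemma maxFun_maxLaw_mono {ρ ρ' σ σ' : Measure ℝ} [IsProbabilityMeasure ρ]
    [IsProbabilityMeasure ρ'] [IsProbabilityMeasure σ] [IsProbabilityMeasure σ']
    (hρ : Integrable id ρ) (hρ' : Integrable id ρ')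
    (hσ : Integrable id σ) (hσ' : Integrable id σ')
    (h : maxFun ρ ≤ maxFun ρ') (h' : maxFun σ ≤ maxFun σ') :
    maxFun (maxLaw ρ σ) ≤ maxFun (maxLaw ρ' σ') := fun c => calc
  maxFun (maxLaw ρ σ) c = ∫ y, maxFun ρ (max y c) ∂σ := maxFun_maxLaw hρ hσ c
  _ ≤ ∫ y, maxFun ρ' (max y c) ∂σ :=
    integral_mono (integrable_maxFun_max hρ hσ c) (integrable_maxFun_max hρ' hσ c) fun _ => h _
  _ = ∫ x, maxFun σ (max x c) ∂ρ' := by rw [← maxFun_maxLaw hρ' hσ, maxFun_maxLaw' hρ' hσ]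
  _ ≤ ∫ x, maxFun σ' (max x c) ∂ρ' :=
    integral_mono (integrable_maxFun_max hσ hρ' c) (integrable_maxFun_max hσ' hρ' c) fun _ => h' _
  _ = maxFun (maxLaw ρ' σ') c := (maxFun_maxLaw' hρ' hσ' c).symm

/-- A set that is null for the law of `max X Y` is null for `X`, provided `X ≪ Y` in law. -/
lemma absolutelyContinuous_maxLaw {ρ σ : Measure ℝ} [IsProbabilityMeasure ρ]
    [IsProbabilityMeasure σ] (h : ρ ≪ σ) : ρ ≪ maxLaw ρ σ := by
  refine Measure.AbsolutelyContinuous.mk fun s hs h0 => ?_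
  rw [maxLaw, Measure.map_apply (by fun_prop) hs] at h0
  have hsub : s ×ˢ s ⊆ (fun z : ℝ × ℝ => max z.1 z.2) ⁻¹' s := by
    rintro ⟨x, y⟩ ⟨hx, hy⟩
    rcases max_choice x y with e | e <;> simpa [e]
  have := measure_mono_null hsub h0
  rw [Measure.prod_prod, mul_eq_zero] at this
  exact this.elim id fun h1 => h h1

/-! ### The law of the maximum of several independent copies -/

/-- The distribution of the maximum of `n + 1` independent variables with distribution `μ`. -/
def iidMaxLaw (μ : Measure ℝ) : ℕ → Measure ℝ
  | 0 => μ
  | n + 1 => maxLaw μ (iidMaxLaw μ n)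

instance (μ : Measure ℝ) [IsProbabilityMeasure μ] (n : ℕ) :
    IsProbabilityMeasure (iidMaxLaw μ n) := by
  induction n with
  | zero => assumption
  | succ n ih => exact inferInstanceAs (IsProbabilityMeasure (maxLaw μ (iidMaxLaw μ n)))

lemma integrable_id_iidMaxLaw {μ : Measure ℝ} [IsProbabilityMeasure μ] (hμ : Integrable id μ)
    (n : ℕ) : Integrable id (iidMaxLaw μ n) := by
  induction n with
  | zero => exact hμ
  | succ n ih => exact integrable_id_maxLaw hμ ih

lemma absolutelyContinuous_iidMaxLaw (μ : Measure ℝ) [IsProbabilityMeasure μ] (n : ℕ) :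
    μ ≪ iidMaxLaw μ n := by
  induction n with
  | zero => exact Measure.AbsolutelyContinuous.rfl
  | succ n ih => exact absolutelyContinuous_maxLaw ih

lemma maxFun_iidMaxLaw_mono {μ ν : Measure ℝ} [IsProbabilityMeasure μ] [IsProbabilityMeasure ν]
    (hμ : Integrable id μ) (hν : Integrable id ν) (h : maxFun μ ≤ maxFun ν) (n : ℕ) :
    maxFun (iidMaxLaw μ n) ≤ maxFun (iidMaxLaw ν n) := by
  induction n with
  | zero => exact h
  | succ n ih =>
    exact maxFun_maxLaw_mono hμ hν (integrable_id_iidMaxLaw hμ n) (integrable_id_iidMaxLaw hν n)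
      h ih

lemma Real.iSup_fin_succ {n : ℕ} (x : Fin (n + 2) → ℝ) :
    ⨆ i, x i = max (x 0) (⨆ i : Fin (n + 1), x i.succ) := by
  apply le_antisymm
  · refine ciSup_le fun i => ?_
    refine Fin.cases (le_max_left _ _) (fun j => ?_) i
    exact le_max_of_le_right (le_ciSup (f := fun i : Fin (n + 1) => x i.succ)
      (Set.finite_range _).bddAbove j)
  · exact max_le (le_ciSup (Set.finite_range x).bddAbove 0)
      (ciSup_le fun j => le_ciSup (Set.finite_range x).bddAbove j.succ)

lemma map_iSup_pi (μ : Measure ℝ) [IsProbabilityMeasure μ] (n : ℕ) :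
    (Measure.pi fun _ : Fin (n + 1) => μ).map (fun x => ⨆ i, x i) = iidMaxLaw μ n := by
  induction n with
  | zero =>
    have h := (measurePreserving_funUnique μ (Fin 1)).map_eq
    rw [iidMaxLaw]
    convert h using 2
    · ext x
      simp
    · congr!
  | succ n ih =>
    have h := (measurePreserving_piFinSuccAbove (fun _ : Fin (n + 2) => μ) 0).map_eq
    have hm : Measurable fun x : Fin (n + 1) → ℝ => ⨆ i, x i :=
      Measurable.iSup fun i => measurable_pi_apply i
    rw [iidMaxLaw, maxLaw, ← ih]
    nth_rewrite 2 [← Measure.map_id (μ := μ)]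
    rw [Measure.map_prod_map _ _ measurable_id hm, ← h,
      Measure.map_map (measurable_id.prodMap hm) (MeasurableEquiv.measurable _),
      Measure.map_map (by fun_prop)
        ((measurable_id.prodMap hm).comp (MeasurableEquiv.measurable _))]
    congr 1
    ext x
    exact Real.iSup_fin_succ x

lemma expMax_eq_integral_iidMaxLaw (μ : Measure ℝ) [IsProbabilityMeasure μ] (n : ℕ) :
    expMax μ (n + 1) = ∫ x, x ∂(iidMaxLaw μ n) := by
  rw [← map_iSup_pi, integral_map
    (Measurable.iSup fun i => measurable_pi_apply i).aemeasurable (by fun_prop)]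
  rfl

/-! ### The energy identity -/

lemma lintegral_ofReal_sub_eq (ρ σ : Measure ℝ) [IsProbabilityMeasure ρ]
    [IsProbabilityMeasure σ] :
    ∫⁻ z, ENNReal.ofReal (z.2 - z.1) ∂(ρ.prod σ) =
      ∫⁻ t, ρ (Set.Iic t) * σ (Set.Ioi t) := by
  let S : Set ((ℝ × ℝ) × ℝ) := {p | p.1.1 ≤ p.2} ∩ {p | p.2 < p.1.2}
  have hS : MeasurableSet S :=
    (measurableSet_le (by fun_prop) (by fun_prop)).inter
      (measurableSet_lt (by fun_prop) (by fun_prop))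
  calc ∫⁻ z, ENNReal.ofReal (z.2 - z.1) ∂(ρ.prod σ)
      = ((ρ.prod σ).prod volume) S := by
        rw [Measure.prod_apply hS]
        refine lintegral_congr fun z => ?_
        rw [← Real.volume_Ico]
        rfl
    _ = ∫⁻ t, ρ (Set.Iic t) * σ (Set.Ioi t) := by
        rw [Measure.prod_apply_symm hS]
        refine lintegral_congr fun t => ?_
        rw [← Measure.prod_prod]
        rfl

lemma measurable_measureReal_Iic (ρ : Measure ℝ) [IsProbabilityMeasure ρ] :
    Measurable fun t => ρ.real (Set.Iic t) :=
  Monotone.measurable fun _ _ h => measureReal_mono (Set.Iic_subset_Iic.2 h)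

lemma measureReal_Ioi_eq (ρ : Measure ℝ) [IsProbabilityMeasure ρ] (t : ℝ) :
    ρ.real (Set.Ioi t) = 1 - ρ.real (Set.Iic t) := by
  rw [← Set.compl_Iic, probReal_compl_eq_one_sub measurableSet_Iic]

lemma integral_cdf_mul_survival {ρ σ : Measure ℝ} [IsProbabilityMeasure ρ]
    [IsProbabilityMeasure σ] (hρ : Integrable id ρ) (hσ : Integrable id σ) :
    Integrable (fun t => ρ.real (Set.Iic t) * (1 - σ.real (Set.Iic t))) ∧
    ∫ t, ρ.real (Set.Iic t) * (1 - σ.real (Set.Iic t)) =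
      ∫ c, maxFun ρ c ∂σ - ∫ x, x ∂ρ := by
  set H : ℝ → ℝ := fun t => ρ.real (Set.Iic t) * (1 - σ.real (Set.Iic t)) with hH
  have hH0 : 0 ≤ H := fun t => by
    simp only [hH, ← measureReal_Ioi_eq]
    positivity
  have hHm : Measurable H :=
    (measurable_measureReal_Iic ρ).mul ((measurable_measureReal_Iic σ).const_sub 1)
  have hmax := integrable_max_prod hρ hσ
  have hfst : Integrable (fun z : ℝ × ℝ => z.1) (ρ.prod σ) := hρ.comp_fst σ
  have hint : Integrable (fun z : ℝ × ℝ => max z.1 z.2 - z.1) (ρ.prod σ) := hmax.sub hfst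
  have hlin : ∫⁻ t, ENNReal.ofReal (H t) =
      ENNReal.ofReal (∫ z : ℝ × ℝ, (max z.1 z.2 - z.1) ∂(ρ.prod σ)) := by
    rw [ofReal_integral_eq_lintegral_ofReal hint (.of_forall fun z => by simp)]
    have h1 : ∀ z : ℝ × ℝ, ENNReal.ofReal (max z.1 z.2 - z.1) = ENNReal.ofReal (z.2 - z.1) := by
      intro z
      rcases le_total z.1 z.2 with h | h
      · rw [max_eq_right h]
      · rw [max_eq_left h, sub_self, ENNReal.ofReal_zero,
          ENNReal.ofReal_of_nonpos (sub_nonpos.2 h)]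
    simp only [h1]
    rw [lintegral_ofReal_sub_eq]
    refine lintegral_congr fun t => ?_
    simp only [hH, ← measureReal_Ioi_eq]
    rw [ENNReal.ofReal_mul measureReal_nonneg, ofReal_measureReal, ofReal_measureReal]
  refine ⟨⟨hHm.aestronglyMeasurable, ?_⟩, ?_⟩
  · rw [hasFiniteIntegral_iff_ofReal (.of_forall hH0), hlin]
    exact ENNReal.ofReal_lt_top
  · rw [integral_eq_lintegral_of_nonneg_ae (.of_forall hH0) hHm.aestronglyMeasurable, hlin,
      ENNReal.toReal_ofReal (integral_nonneg fun z => by simp), integral_sub hmax hfst,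
      integral_prod_symm _ hmax]
    congr 1
    simpa using integral_fun_fst (μ := ρ) (ν := σ) (fun x : ℝ => x)

lemma eq_of_cdf_ae_eq {μ ν : Measure ℝ} [IsProbabilityMeasure μ] [IsProbabilityMeasure ν]
    (h : ∀ᵐ t : ℝ, μ.real (Set.Iic t) = ν.real (Set.Iic t)) : μ = ν := by
  apply Measure.eq_of_cdf
  ext t
  by_contra hne
  have hev : ∀ᶠ s in 𝓝[≥] t, cdf μ s ≠ cdf ν s :=
    
    (((cdf μ).right_continuous t).prodMk ((cdf ν).right_continuous t)).eventually
      (isOpen_ne_fun continuous_fst continuous_snd |>.mem_nhds hne)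
  obtain ⟨u, hu, hsub⟩ := mem_nhdsGE_iff_exists_Ico_subset.1 hev
  have h0 : volume (Set.Ico t u) = 0 :=
    measure_mono_null (fun s hs => by simpa [cdf_eq_real] using hsub hs) (ae_iff.1 h)
  rw [Real.volume_Ico, ENNReal.ofReal_eq_zero] at h0
  exact absurd h0 (by simpa using hu)

/-- Two integrable distributions whose functions `c ↦ E max(X, c)` agree
almost everywhere with respect to both distributions are equal. -/
lemma eq_of_maxFun_ae_eq {μ ν : Measure ℝ} [IsProbabilityMeasure μ] [IsProbabilityMeasure ν]
    (hμ : Integrable id μ) (hν : Integrable id ν)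
    (h1 : maxFun μ =ᵐ[μ] maxFun ν) (h2 : maxFun μ =ᵐ[ν] maxFun ν) : μ = ν := by
  obtain ⟨iμμ, eμμ⟩ := integral_cdf_mul_survival hμ hμ
  obtain ⟨iμν, eμν⟩ := integral_cdf_mul_survival hμ hν
  obtain ⟨iνμ, eνμ⟩ := integral_cdf_mul_survival hν hμ
  obtain ⟨iνν, eνν⟩ := integral_cdf_mul_survival hν hν
  have hsq : ∀ t, (μ.real (Set.Iic t) - ν.real (Set.Iic t)) ^ 2 =
      (μ.real (Set.Iic t) * (1 - ν.real (Set.Iic t)) -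
        μ.real (Set.Iic t) * (1 - μ.real (Set.Iic t))) +
      (ν.real (Set.Iic t) * (1 - μ.real (Set.Iic t)) -
        ν.real (Set.Iic t) * (1 - ν.real (Set.Iic t))) := fun t => by ring
  have hint : Integrable fun t => (μ.real (Set.Iic t) - ν.real (Set.Iic t)) ^ 2 := by
    simp only [hsq]
    exact (iμν.sub iμμ).add (iνμ.sub iνν)
  have hzero : ∫ t, (μ.real (Set.Iic t) - ν.real (Set.Iic t)) ^ 2 = 0 := by
    simp only [hsq]
    rw [integral_add (by exact iμν.sub iμμ) (by exact iνμ.sub iνν), integral_sub iμν iμμ, integral_sub iνμ iνν,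
      eμν, eμμ, eνμ, eνν]
    have a := integral_congr_ae h1
    have b := integral_congr_ae h2
    have c := integral_maxFun_comm hμ hν
    linarith
  have hae := (integral_eq_zero_iff_of_nonneg (fun t => sq_nonneg _) hint).1 hzero
  refine eq_of_cdf_ae_eq ?_
  filter_upwards [hae] with t ht
  exact sub_eq_zero.1 (pow_eq_zero_iff two_ne_zero |>.1 ht)

/-! ### Convex order and reflection -/

lemma ConvexOrder.maxFun_le {μ ν : Measure ℝ} [IsProbabilityMeasure μ] [IsProbabilityMeasure ν]
    (h : ConvexOrder μ ν) (hμ : Integrable id μ) (hν : Integrable id ν) :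
    maxFun μ ≤ maxFun ν := fun c =>
  h (fun x => max x c) ((convexOn_id convex_univ).sup (convexOn_const c convex_univ))
    (integrable_max_const hμ c) (integrable_max_const hν c)

lemma ConvexOrder.map_neg {μ ν : Measure ℝ} (h : ConvexOrder μ ν) :
    ConvexOrder (μ.map Neg.neg) (ν.map Neg.neg) := by
  intro φ hφ h1 h2
  have e : MeasurableEmbedding (Neg.neg : ℝ → ℝ) := (MeasurableEquiv.neg ℝ).measurableEmbedding
  rw [e.integrable_map_iff] at h1 h2
  rw [e.integral_map, e.integral_map]
  exact h _ (hφ.comp_linearMap (-LinearMap.id)) h1 h2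

lemma integrable_id_map_neg {μ : Measure ℝ} (hμ : Integrable id μ) :
    Integrable id (μ.map Neg.neg) := by
  rw [integrable_map_measure (by fun_prop) (by fun_prop)]
  exact hμ.neg

lemma expMax_map_neg (μ : Measure ℝ) [IsProbabilityMeasure μ] (k : ℕ) :
    expMax (μ.map Neg.neg) k = -expMin μ k := by
  have : IsProbabilityMeasure (μ.map Neg.neg) :=
    Measure.isProbabilityMeasure_map (by fun_prop)
  have hm : Measurable fun (x : Fin k → ℝ) i => -x i :=
    measurable_pi_lambda _ fun i => (measurable_pi_apply i).neg
  rw [expMax, expMin, ← Measure.pi_map_pi (μ := fun _ : Fin k => μ)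
    (f := fun _ => Neg.neg) (fun _ => by fun_prop), integral_map hm.aemeasurable
    (Measurable.iSup fun i => measurable_pi_apply i).aestronglyMeasurable, ← integral_neg]
  refine integral_congr_ae (.of_forall fun x => ?_)
  simp only [iSup, iInf]
  rw [← Real.sSup_neg]
  congr 1
  ext y
  simp [neg_eq_iff_eq_neg]

lemma eq_of_convexOrder_of_expMax_eq {μ ν : Measure ℝ} [IsProbabilityMeasure μ]
    [IsProbabilityMeasure ν] (hμ : Integrable id μ) (hν : Integrable id ν)
    (hcx : ConvexOrder μ ν) {k : ℕ} (hk : 2 ≤ k) (heq : expMax μ k = expMax ν k) : μ = ν := by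
  obtain ⟨n, rfl⟩ := Nat.exists_eq_add_of_le' hk
  have hle := hcx.maxFun_le hμ hν
  have hμn := integrable_id_iidMaxLaw hμ n
  have hνn := integrable_id_iidMaxLaw hν n
  rw [expMax_eq_integral_iidMaxLaw, expMax_eq_integral_iidMaxLaw, iidMaxLaw, iidMaxLaw,
    integral_id_maxLaw hμ hμn, integral_id_maxLaw hν hνn] at heq
  have mono (σ : Measure ℝ) [IsProbabilityMeasure σ] (hσ : Integrable id σ) :
      ∫ c, maxFun μ c ∂σ ≤ ∫ c, maxFun ν c ∂σ :=
    integral_mono (integrable_maxFun hμ hσ) (integrable_maxFun hν hσ) hle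
  have mono' (σ : Measure ℝ) [IsProbabilityMeasure σ] (hσ : Integrable id σ) :
      ∫ c, maxFun σ c ∂(iidMaxLaw μ n) ≤ ∫ c, maxFun σ c ∂(iidMaxLaw ν n) := by
    rw [integral_maxFun_comm hσ hμn, integral_maxFun_comm hσ hνn]
    exact integral_mono (integrable_maxFun hμn hσ) (integrable_maxFun hνn hσ)
      (maxFun_iidMaxLaw_mono hμ hν hle n)
  have e1 : ∫ c, maxFun μ c ∂(iidMaxLaw μ n) = ∫ c, maxFun ν c ∂(iidMaxLaw μ n) :=
    le_antisymm (mono _ hμn) (heq ▸ mono' ν hν)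
  have e2 : ∫ c, maxFun μ c ∂(iidMaxLaw ν n) = ∫ c, maxFun ν c ∂(iidMaxLaw ν n) :=
    le_antisymm (mono _ hνn) (heq ▸ mono' μ hμ)
  rw [integral_eq_iff_of_ae_le (integrable_maxFun hμ hμn) (integrable_maxFun hν hμn)
    (.of_forall hle)] at e1
  rw [integral_eq_iff_of_ae_le (integrable_maxFun hμ hνn) (integrable_maxFun hν hνn)
    (.of_forall hle)] at e2
  exact eq_of_maxFun_ae_eq hμ hν
    ((absolutelyContinuous_iidMaxLaw μ n).ae_eq e1)
    ((absolutelyContinuous_iidMaxLaw ν n).ae_eq e2)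

/-- If `X ≤cx Y` and for some `k ≥ 2` the expected minima (or the expected
maxima) of `k` independent copies coincide, then `X` and `Y` have the same distribution. -/
theorem eq_of_convexOrder_of_expected_extreme_eq
    (μ ν : Measure ℝ) [IsProbabilityMeasure μ] [IsProbabilityMeasure ν]
    (hμ : Integrable id μ) (hν : Integrable id ν)
    (hcx : ConvexOrder μ ν)
    (k : ℕ) (hk : 2 ≤ k)
    (heq : expMin μ k = expMin ν k ∨ expMax μ k = expMax ν k) :
    μ = ν := by
  rcases heq with h | h
  · have : IsProbabilityMeasure (μ.map Neg.neg) :=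
      Measure.isProbabilityMeasure_map (by fun_prop)
    have : IsProbabilityMeasure (ν.map Neg.neg) :=
      Measure.isProbabilityMeasure_map (by fun_prop)
    have hmap : μ.map Neg.neg = ν.map Neg.neg :=
      eq_of_convexOrder_of_expMax_eq (integrable_id_map_neg hμ) (integrable_id_map_neg hν)
        hcx.map_neg hk (by rw [expMax_map_neg, expMax_map_neg, h])
    exact (MeasurableEquiv.neg ℝ).map_measurableEquiv_injective hmap
  · exact eq_of_convexOrder_of_expMax_eq hμ hν hcx hk h

end
end

section
/- For every θ > 0 and 0 ≤ p₁ < p₂ < 1, the zero-inflated Poisson variables satisfy Y(θ,p₁) ≤cx Y(θ,p₂). -/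
open MeasureTheory Filter Topology ProbabilityTheory

noncomputable section

lemma poissonPMFReal_nonneg {lam : ℝ} (h : 0 ≤ lam) (k : ℕ) : 0 ≤ _root_.poissonPMFReal lam k := by
  unfold _root_.poissonPMFReal
  positivity

lemma hasSum_poissonPMFReal (lam : ℝ) : HasSum (_root_.poissonPMFReal lam) 1 := by
  have h := (NormedSpace.expSeries_div_hasSum_exp lam).mul_left (Real.exp (-lam))
  rw [← Real.exp_eq_exp_ℝ, ← Real.exp_add, neg_add_cancel, Real.exp_zero] at h
  refine h.congr_fun fun k => ?_
  rw [_root_.poissonPMFReal, mul_div_assoc]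

lemma hasSum_poissonPMFReal_mul_id (lam : ℝ) :
    HasSum (fun k : ℕ => _root_.poissonPMFReal lam k * k) lam := by
  rw [← hasSum_nat_add_iff' 1]
  have h := (hasSum_poissonPMFReal lam).mul_left lam
  simp only [Finset.sum_range_one, Nat.cast_zero, mul_zero, sub_zero]
  rw [mul_one] at h
  refine h.congr_fun fun k => ?_
  simp only [_root_.poissonPMFReal, Nat.factorial_succ]
  push_cast
  field_simp
  ring

lemma hasSum_integral_discreteMeasure {w : ℕ → ℝ} (hw : ∀ k, 0 ≤ w k) {f : ℝ → ℝ}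
    (hf : Integrable f (discreteMeasure w)) :
    HasSum (fun k : ℕ => w k * f k) (∫ x, f x ∂discreteMeasure w) := by
  refine (hasSum_integral_measure hf).congr_fun fun k => ?_
  rw [integral_smul_measure, integral_dirac, ENNReal.toReal_ofReal (hw k), smul_eq_mul]

/-- The integral of `f` against `ZIP θ p`, expanded relative to the line of slope `s` that meets
the graph of `f` at `0`. -/
lemma hasSum_integral_ZIP {θ p : ℝ} (hθ : 0 < θ) (hp₀ : 0 ≤ p) (hp₁ : p < 1) {f : ℝ → ℝ}
    (hf : Integrable f (ZIP θ p)) (s : ℝ) :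
    HasSum (fun k : ℕ => (1 - p) * _root_.poissonPMFReal (θ / (1 - p)) k * (f k - f 0 - s * k))
      (∫ x, f x ∂ZIP θ p - f 0 - s * θ) := by
  have hq : 0 < 1 - p := sub_pos.2 hp₁
  unfold ZIP ziMeasure at hf ⊢
  have hf' := integrable_add_measure.1 hf
  have hP : Integrable f (_root_.poissonMeasure (θ / (1 - p))) :=
    (integrable_smul_measure (by simpa using hp₁) ENNReal.ofReal_ne_top).1 hf'.2
  rw [integral_add_measure hf'.1 hf'.2, integral_smul_measure, integral_smul_measure,
    integral_dirac, ENNReal.toReal_ofReal hp₀, ENNReal.toReal_ofReal hq.le, smul_eq_mul,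
    smul_eq_mul]
  have hS : HasSum (fun k : ℕ => _root_.poissonPMFReal (θ / (1 - p)) k * f k)
      (∫ x, f x ∂_root_.poissonMeasure (θ / (1 - p))) :=
    hasSum_integral_discreteMeasure (poissonPMFReal_nonneg (div_pos hθ hq).le) hP
  have h := ((hS.sub ((hasSum_poissonPMFReal (θ / (1 - p))).mul_right (f 0))).sub
    ((hasSum_poissonPMFReal_mul_id (θ / (1 - p))).mul_left s)).mul_left (1 - p)
  have hval : ∀ I : ℝ, p * f 0 + (1 - p) * I - f 0 - s * θ =
      (1 - p) * (I - 1 * f 0 - s * (θ / (1 - p))) := fun I => by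
    field_simp
    ring
  rw [hval]
  exact h.congr_fun fun k => by ring

lemma ZIP_weight_succ_eq {θ p : ℝ} (hθ : 0 < θ) (hp : p < 1) (k : ℕ) :
    (1 - p) * _root_.poissonPMFReal (θ / (1 - p)) (k + 1) =
      θ / (k + 1).factorial * Real.exp (k * Real.log (θ / (1 - p)) - θ / (1 - p)) := by
  have hq : 0 < 1 - p := sub_pos.2 hp
  have hl : 0 < θ / (1 - p) := div_pos hθ hq
  have hθl : (1 - p) * (θ / (1 - p)) = θ := by field_simp
  rw [_root_.poissonPMFReal, sub_eq_add_neg (_ * _), Real.exp_add, Real.exp_nat_mul,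
    Real.exp_log hl, pow_succ]
  nth_rewrite 4 [← hθl]
  ring

/-- For every `θ > 0` and `0 ≤ p₁ < p₂ < 1`, the zero-inflated Poisson
distributions satisfy `Y(θ,p₁) ≤cx Y(θ,p₂)`. -/
theorem zip_convexOrder (θ p₁ p₂ : ℝ) (hθ : 0 < θ)
    (hp₁ : 0 ≤ p₁) (hp₁₂ : p₁ < p₂) (hp₂ : p₂ < 1) :
    ConvexOrder (ZIP θ p₁) (ZIP θ p₂) := by
  intro φ hφ h₁ h₂
  have hp₁' : p₁ < 1 := hp₁₂.trans hp₂
  have hq₂ : 0 < 1 - p₂ := sub_pos.2 hp₂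
  have hl₁ : 0 < θ / (1 - p₁) := div_pos hθ (sub_pos.2 hp₁')
  have hlt : θ / (1 - p₁) < θ / (1 - p₂) :=
    div_lt_div_of_pos_left hθ hq₂ (by linarith)
  have hlog : 0 < Real.log (θ / (1 - p₂)) - Real.log (θ / (1 - p₁)) :=
    sub_pos.2 (Real.log_lt_log hl₁ hlt)
  -- `a + 1` is the point at which the weights of the two distributions cross.
  obtain ⟨a, ha, hcross⟩ : ∃ a : ℝ, 0 < a ∧
      a * (Real.log (θ / (1 - p₂)) - Real.log (θ / (1 - p₁))) = θ / (1 - p₂) - θ / (1 - p₁) :=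
    ⟨_, div_pos (sub_pos.2 hlt) hlog, div_mul_cancel₀ _ hlog.ne'⟩
  set s := (φ (a + 1) - φ 0) / (a + 1 - 0) with hs
  have key := hasSum_le (fun k => ?_) (hasSum_integral_ZIP hθ hp₁ hp₁' h₁ s)
    (hasSum_integral_ZIP hθ (hp₁.trans hp₁₂.le) hp₂ h₂ s)
  · linarith
  rcases k with _ | k
  · simp
  have hk : (0 : ℝ) < (k + 1 : ℕ) := by positivity
  have hslope : φ (k + 1 : ℕ) - φ 0 - s * (k + 1 : ℕ) =
      ((φ (k + 1 : ℕ) - φ 0) / ((k + 1 : ℕ) - 0) - s) * (k + 1 : ℕ) := by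
    rw [sub_zero ((k + 1 : ℕ) : ℝ), sub_mul, div_mul_cancel₀ _ hk.ne']
  rw [ZIP_weight_succ_eq hθ hp₁', ZIP_weight_succ_eq hθ hp₂, hslope]
  rcases le_total a k with hak | hka
  · refine mul_le_mul_of_nonneg_right ?_ (mul_nonneg (sub_nonneg.2 ?_) hk.le)
    · refine mul_le_mul_of_nonneg_left (Real.exp_le_exp.2 ?_) (by positivity)
      linarith [mul_le_mul_of_nonneg_right hak hlog.le]
    · exact hφ.secant_mono trivial trivial trivial (by positivity) hk.ne' (by push_cast; linarith)
  · refine mul_le_mul_of_nonpos_right ?_ (mul_nonpos_of_nonpos_of_nonneg (sub_nonpos.2 ?_) hk.le)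
    · refine mul_le_mul_of_nonneg_left (Real.exp_le_exp.2 ?_) (by positivity)
      linarith [mul_le_mul_of_nonneg_right hka hlog.le]
    · exact hφ.secant_mono trivial trivial trivial hk.ne' (by positivity) (by push_cast; linarith)

end
end

section
/- For every integer m ≥ 1 and all 0 ≤ p₁ < p₂ < 1 and 0 < θ ≤ m(1-p₂), the zero-inflated binomial variables satisfy X(m,θ,p₁) ≤cx X(m,θ,p₂). -/
open MeasureTheory Filter Topology ProbabilityTheory

noncomputable section

/-- The expectation `E[f(B)]` for `B` binomial with parameters `m` and `q`. -/
def binomialExpect (m : ℕ) (q : ℝ) (f : ℕ → ℝ) : ℝ :=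
  ∑ k ∈ Finset.range (m + 1), binomialPMFReal m q k * f k

lemma binomialPMFReal_nonneg (m : ℕ) {q : ℝ} (hq₀ : 0 ≤ q) (hq₁ : q ≤ 1) (k : ℕ) :
    0 ≤ binomialPMFReal m q k := by
  have : 0 ≤ 1 - q := sub_nonneg.2 hq₁
  unfold binomialPMFReal
  positivity

lemma binomialExpect_zero (q : ℝ) (f : ℕ → ℝ) : binomialExpect 0 q f = f 0 := by
  simp [binomialExpect, binomialPMFReal]

/-- Conditioning on the outcome of a single trial. -/
lemma binomialExpect_succ (m : ℕ) (q : ℝ) (f : ℕ → ℝ) :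
    binomialExpect (m + 1) q f =
      (1 - q) * binomialExpect m q f + q * binomialExpect m q fun k => f (k + 1) := by
  have h := Finset.sum_choose_succ_mul (fun i j => q ^ i * (1 - q) ^ j * f i) m
  simp only [binomialExpect, binomialPMFReal, Finset.mul_sum]
  calc _ = _ := Finset.sum_congr rfl fun k _ => by ring
    _ = _ := h
    _ = _ := by
      congr 1
      · refine Finset.sum_congr rfl fun k hk => ?_
        rw [Nat.succ_sub (Finset.mem_range_succ_iff.1 hk), pow_succ]
        ring
      · exact Finset.sum_congr rfl fun k _ => by rw [pow_succ]; ring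

lemma binomialExpect_add (m : ℕ) (q : ℝ) (f g : ℕ → ℝ) :
    (binomialExpect m q fun k => f k + g k) = binomialExpect m q f + binomialExpect m q g := by
  simp only [binomialExpect, mul_add, Finset.sum_add_distrib]

lemma binomialExpect_const_mul (m : ℕ) (q c : ℝ) (f : ℕ → ℝ) :
    (binomialExpect m q fun k => c * f k) = c * binomialExpect m q f := by
  simp only [binomialExpect, Finset.mul_sum]
  exact Finset.sum_congr rfl fun k _ => by ring

lemma binomialExpect_const (m : ℕ) (q c : ℝ) : (binomialExpect m q fun _ => c) = c := by
  induction m with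
  | zero => exact binomialExpect_zero q _
  | succ m ih => rw [binomialExpect_succ, ih]; ring

lemma binomialExpect_mono (m : ℕ) {q : ℝ} (hq₀ : 0 ≤ q) (hq₁ : q ≤ 1) {f g : ℕ → ℝ}
    (h : ∀ k, f k ≤ g k) : binomialExpect m q f ≤ binomialExpect m q g :=
  Finset.sum_le_sum fun k _ =>
    mul_le_mul_of_nonneg_left (h k) (binomialPMFReal_nonneg m hq₀ hq₁ k)

/-- Binomial thinning of a binomial variable is binomial. -/
lemma binomialExpect_thinning (m : ℕ) (t q : ℝ) (f : ℕ → ℝ) :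
    (binomialExpect m q fun n => binomialExpect n t f) = binomialExpect m (t * q) f := by
  induction m generalizing f with
  | zero => simp only [binomialExpect_zero]
  | succ m ih =>
    simp only [binomialExpect_succ, binomialExpect_add, binomialExpect_const_mul, ih]
    ring

lemma ConvexOn.add_le_natCast_succ {φ : ℝ → ℝ} (hφ : ConvexOn ℝ Set.univ φ) {a : ℝ}
    (n : ℕ) : φ (a + n) + φ (a + 1) ≤ φ (a + (n + 1)) + φ a := by
  have hn : (0 : ℝ) < n + 1 := by positivity
  obtain ⟨c, hc⟩ : ∃ c : ℝ, c = n / (n + 1) := ⟨_, rfl⟩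
  have hcn : c * (n + 1) = n := by rw [hc, div_mul_cancel₀ _ hn.ne']
  have hc₀ : 0 ≤ c := by rw [hc]; positivity
  have hc₁ : 0 ≤ 1 - c := by rw [hc, sub_nonneg, div_le_one hn]; linarith
  have h₁ := hφ.2 (Set.mem_univ a) (Set.mem_univ (a + (n + 1))) hc₁ hc₀ (by ring)
  have h₂ := hφ.2 (Set.mem_univ a) (Set.mem_univ (a + (n + 1))) hc₀ hc₁ (by ring)
  simp only [smul_eq_mul] at h₁ h₂
  rw [show (1 - c) * a + c * (a + (n + 1)) = a + n by linear_combination hcn] at h₁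
  rw [show c * a + (1 - c) * (a + (n + 1)) = a + 1 by linear_combination -hcn] at h₂
  linarith

/-- A binomial expectation of a convex function is at most the value given by its chord. -/
lemma ConvexOn.binomialExpect_le_chord {φ : ℝ → ℝ} (hφ : ConvexOn ℝ Set.univ φ) {t : ℝ}
    (ht₀ : 0 ≤ t) (ht₁ : t ≤ 1) (n : ℕ) (a : ℝ) :
    (binomialExpect n t fun k => φ (a + k)) ≤ t * φ (a + n) + (1 - t) * φ a := by
  induction n generalizing a with
  | zero => rw [binomialExpect_zero]; simp only [Nat.cast_zero, add_zero]; linarith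
  | succ n ih =>
    have ht : 0 ≤ 1 - t := sub_nonneg.2 ht₁
    have h₁ := mul_le_mul_of_nonneg_left (ih a) ht
    have h₂ := mul_le_mul_of_nonneg_left (ih (a + 1)) ht₀
    have h₃ := mul_le_mul_of_nonneg_left (hφ.add_le_natCast_succ (a := a) n) (mul_nonneg ht₀ ht)
    simp only [binomialExpect_succ, Nat.cast_add, Nat.cast_one]
    simp only [show ∀ x : ℝ, a + 1 + x = a + (x + 1) from fun x => by ring] at h₂
    linarith

/-- Scaling down the success probability: `E φ(Bin(m, tq)) ≤ t E φ(Bin(m, q)) + (1 - t) φ(0)`. -/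
lemma ConvexOn.binomialExpect_mul_le {φ : ℝ → ℝ} (hφ : ConvexOn ℝ Set.univ φ) (m : ℕ) {t q : ℝ}
    (ht₀ : 0 ≤ t) (ht₁ : t ≤ 1) (hq₀ : 0 ≤ q) (hq₁ : q ≤ 1) :
    (binomialExpect m (t * q) fun k => φ k) ≤
      t * (binomialExpect m q fun k => φ k) + (1 - t) * φ 0 := by
  rw [← binomialExpect_thinning]
  calc _ ≤ binomialExpect m q fun n => t * φ n + (1 - t) * φ 0 :=
        binomialExpect_mono m hq₀ hq₁ fun n => by
          simpa only [zero_add] using hφ.binomialExpect_le_chord ht₀ ht₁ n 0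
    _ = _ := by rw [binomialExpect_add, binomialExpect_const_mul, binomialExpect_const]

lemma integral_binomialMeasure {m : ℕ} {q : ℝ} (hq₀ : 0 ≤ q) (hq₁ : q ≤ 1) {φ : ℝ → ℝ}
    (hφ : Integrable φ (binomialMeasure m q)) :
    ∫ x, φ x ∂binomialMeasure m q = binomialExpect m q fun k => φ k := by
  rw [binomialMeasure, discreteMeasure] at hφ ⊢
  rw [integral_sum_measure hφ]
  simp only [integral_smul_measure, integral_dirac, smul_eq_mul,
    ENNReal.toReal_ofReal (binomialPMFReal_nonneg m hq₀ hq₁ _)]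
  refine tsum_eq_sum fun k hk => ?_
  rw [Finset.mem_range, not_lt] at hk
  simp [binomialPMFReal, Nat.choose_eq_zero_of_lt hk]

lemma integral_ziMeasure {p : ℝ} (hp₀ : 0 ≤ p) (hp₁ : p < 1) {μ : Measure ℝ} {φ : ℝ → ℝ}
    (hφ : Integrable φ μ) :
    ∫ x, φ x ∂ziMeasure p μ = p * φ 0 + (1 - p) * ∫ x, φ x ∂μ := by
  have hδ : Integrable φ (Measure.dirac (0 : ℝ)) := integrable_dirac enorm_lt_top
  rw [ziMeasure, integral_add_measure (hδ.smul_measure ENNReal.ofReal_ne_top)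
    (hφ.smul_measure ENNReal.ofReal_ne_top)]
  simp only [integral_smul_measure, integral_dirac, smul_eq_mul, ENNReal.toReal_ofReal hp₀,
    ENNReal.toReal_ofReal (sub_nonneg.2 hp₁.le)]

lemma integrable_of_integrable_ziMeasure {p : ℝ} (hp₁ : p < 1) {μ : Measure ℝ} {φ : ℝ → ℝ}
    (hφ : Integrable φ (ziMeasure p μ)) : Integrable φ μ :=
  (integrable_smul_measure (ENNReal.ofReal_pos.2 (sub_pos.2 hp₁)).ne' ENNReal.ofReal_ne_top).1
    (integrable_add_measure.1 hφ).2

lemma integral_ZIB {m : ℕ} {θ p : ℝ} (hp₀ : 0 ≤ p) (hp₁ : p < 1)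
    (hθ : 0 ≤ θ) (hθm : θ ≤ m * (1 - p)) {φ : ℝ → ℝ} (hφ : Integrable φ (ZIB m θ p)) :
    ∫ x, φ x ∂ZIB m θ p =
      p * φ 0 + (1 - p) * binomialExpect m (θ / (m * (1 - p))) fun k => φ k := by
  have hμ := integrable_of_integrable_ziMeasure hp₁ hφ
  have h : 0 ≤ m * (1 - p) := hθ.trans hθm
  rw [ZIB, integral_ziMeasure hp₀ hp₁ hμ,
    integral_binomialMeasure (div_nonneg hθ h) (div_le_one_of_le₀ hθm h) hμ]

/-- For every integer `m ≥ 1`, all `0 ≤ p₁ < p₂ < 1` and `0 < θ ≤ m(1-p₂)`,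
the zero-inflated binomial distributions satisfy `X(m,θ,p₁) ≤cx X(m,θ,p₂)`. -/
theorem zib_convexOrder (m : ℕ) (hm : 1 ≤ m) (θ p₁ p₂ : ℝ)
    (hp₁ : 0 ≤ p₁) (hp₁₂ : p₁ < p₂) (hp₂ : p₂ < 1)
    (hθ : 0 < θ) (hθm : θ ≤ m * (1 - p₂)) :
    ConvexOrder (ZIB m θ p₁) (ZIB m θ p₂) := by
  intro φ hφ h₁ h₂
  have hm₀ : (0 : ℝ) < m := by exact_mod_cast hm
  have hs₂ : 0 < 1 - p₂ := sub_pos.2 hp₂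
  have hs₁ : 0 < 1 - p₁ := by linarith
  have hθm₁ : θ ≤ m * (1 - p₁) :=
    hθm.trans (mul_le_mul_of_nonneg_left (by linarith) hm₀.le)
  rw [integral_ZIB hp₁ (hp₁₂.trans hp₂) hθ.le hθm₁ h₁,
    integral_ZIB (hp₁.trans hp₁₂.le) hp₂ hθ.le hθm h₂]
  have key := hφ.binomialExpect_mul_le m (t := (1 - p₂) / (1 - p₁)) (q := θ / (m * (1 - p₂)))
    (by positivity) ((div_le_one hs₁).2 (by linarith)) (by positivity)
    ((div_le_one (by positivity)).2 hθm)
  rw [show (1 - p₂) / (1 - p₁) * (θ / (m * (1 - p₂))) = θ / (m * (1 - p₁)) by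
    field_simp] at key
  have key' := mul_le_mul_of_nonneg_left key hs₁.le
  rw [mul_add, ← mul_assoc, ← mul_assoc, mul_one_sub (1 - p₁) ((1 - p₂) / (1 - p₁)),
    mul_div_cancel₀ _ hs₁.ne'] at key'
  linarith

end
end
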